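/- arXiv:math/0507036 — 2 statements merged into one kernel-verified Lean document; each statement's English description precedes it below -/
import Mathlib

section
/- For every 0 ≤ q ≤ n, the relation (Λ^q V)^{n−q} = (F_q)^q holds as an identity of endomorphisms of Λ^q M; in particular Λ^q M is a module over R/(V^{n−q} − F^q). -/
set_option synthInstance.maxHeartbeats 1000000
set_option maxHeartbeats 1000000

/-! Statement 3: for `0 ≤ q ≤ n`, the relation `(Λ^q V)^(n-q) = (F_q)^q` holds on `Λ^q M`,
where `F_q` is the unique endomorphism with `F_q ∘ Λ^q V = p·id`. -/

noncomputable section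

/-- The Verschiebung operator `V` on `M = ℤ_p^n`, determined by
`V a₀ = p·a_{n-1}` and `V aᵢ = a_{i-1}` for `i ≥ 1`. -/
def Vmap (p n : ℕ) [Fact p.Prime] : Module.End ℤ_[p] (Fin n → ℤ_[p]) :=
  LinearMap.pi fun j =>
    if h : (j : ℕ) + 1 < n then LinearMap.proj (⟨(j : ℕ) + 1, h⟩ : Fin n)
    else (p : ℤ_[p]) • LinearMap.proj (⟨0, j.pos⟩ : Fin n)

/-- The Frobenius operator `F` on `M = ℤ_p^n`, determined by
`F aᵢ = p·a_{i+1}` for `i ≤ n-2` and `F a_{n-1} = a₀`. -/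
def Fmap (p n : ℕ) [Fact p.Prime] : Module.End ℤ_[p] (Fin n → ℤ_[p]) :=
  LinearMap.pi fun j =>
    if _ : (j : ℕ) = 0 then LinearMap.proj (⟨n - 1, Nat.sub_lt j.pos Nat.one_pos⟩ : Fin n)
    else (p : ℤ_[p]) •
      LinearMap.proj (⟨(j : ℕ) - 1, lt_of_le_of_lt (Nat.sub_le _ _) j.isLt⟩ : Fin n)

/-- The endomorphism `Λ^q f` of the `q`-th exterior power (a submodule of the
exterior algebra) induced by an endomorphism `f` of `M`. -/
def extPowMap {R : Type} [CommRing R] {M : Type} [AddCommGroup M] [Module R M]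
    (q : ℕ) (f : M →ₗ[R] M) : Module.End R (⋀[R]^q M) :=
  (ExteriorAlgebra.map f).toLinearMap.restrict (p := ⋀[R]^q M) (q := ⋀[R]^q M)
    (fun x hx => by
      have h2 : Submodule.map (ExteriorAlgebra.map f).toLinearMap
          (LinearMap.range (ExteriorAlgebra.ι R (M := M))) ≤
          LinearMap.range (ExteriorAlgebra.ι R (M := M)) := by
        rw [ExteriorAlgebra.ι_range_map_map]
        exact LinearMap.map_le_range
      have h1 : Submodule.map (ExteriorAlgebra.map f).toLinearMap (⋀[R]^q M) ≤ ⋀[R]^q M := by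
        rw [ExteriorAlgebra.exteriorPower, Submodule.map_pow]
        exact pow_le_pow_left' h2 q
      exact h1 (Submodule.mem_map_of_mem hx))

theorem Vmap_pow_apply (p n : ℕ) [Fact p.Prime] (k : ℕ) (hk : k ≤ n) (x : Fin n → ℤ_[p])
    (j : Fin n) : ((Vmap p n) ^ k) x j =
      if h : (j : ℕ) + k < n then x ⟨j + k, h⟩
      else (p : ℤ_[p]) * x ⟨j + k - n, by have := j.isLt; omega⟩ := by
  induction k generalizing x with
  | zero => simp
  | succ k ih =>
    rw [pow_succ, Module.End.mul_apply, ih (by omega)]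
    have hj := j.isLt
    by_cases h1 : (j : ℕ) + k < n
    · by_cases h2 : (j : ℕ) + k + 1 < n
      · have h3 : (j : ℕ) + (k + 1) < n := by omega
        simp only [h1, h3, dif_pos]
        simp [Vmap, h3, add_assoc]
      · have h3 : ¬ (j : ℕ) + (k + 1) < n := by omega
        have h4 : (j : ℕ) + (k + 1) - n = 0 := by omega
        simp only [h1, h3, dif_pos, dif_neg, not_false_eq_true]
        simp [Vmap, h2, h4]
    · have h3 : ¬ (j : ℕ) + (k + 1) < n := by omega
      have h2 : (j : ℕ) + k - n + 1 < n := by omega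
      have h4 : (j : ℕ) + (k + 1) - n = j + k - n + 1 := by omega
      simp only [h1, h3, dif_neg, not_false_eq_true]
      simp [Vmap, h2, h4]

theorem Vmap_pow_n (p n : ℕ) [Fact p.Prime] :
    (Vmap p n) ^ n = (p : ℤ_[p]) • (1 : Module.End ℤ_[p] (Fin n → ℤ_[p])) := by
  refine LinearMap.ext fun x => funext fun j => ?_
  rw [Vmap_pow_apply p n n le_rfl]
  simp

theorem extPowMap_mul {R : Type} [CommRing R] {M : Type} [AddCommGroup M] [Module R M]
    (q : ℕ) (f g : M →ₗ[R] M) :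
    extPowMap q (f ∘ₗ g) = extPowMap q f * extPowMap q g := by
  refine LinearMap.ext fun x => Subtype.ext ?_
  change ExteriorAlgebra.map (f ∘ₗ g) (x : ExteriorAlgebra R M) =
    ExteriorAlgebra.map f (ExteriorAlgebra.map g (x : ExteriorAlgebra R M))
  rw [← ExteriorAlgebra.map_comp_map]
  rfl

theorem extPowMap_smul_one {R : Type} [CommRing R] {M : Type} [AddCommGroup M] [Module R M]
    (q : ℕ) (c : R) :
    extPowMap q (c • (1 : Module.End R M)) = c ^ q • (1 : Module.End R (⋀[R]^q M)) := by
  apply exteriorPower.linearMap_ext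
  ext v
  change ExteriorAlgebra.map (c • (1 : Module.End R M)) (ExteriorAlgebra.ιMulti R q v) =
    c ^ q • (ExteriorAlgebra.ιMulti R q v)
  rw [ExteriorAlgebra.map_apply_ιMulti]
  have := (ExteriorAlgebra.ιMulti R q (M := M)).map_smul_univ (fun _ => c) v
  simpa [Function.comp_def] using this

theorem extPowMap_pow {R : Type} [CommRing R] {M : Type} [AddCommGroup M] [Module R M]
    (q : ℕ) (f : Module.End R M) (k : ℕ) :
    extPowMap q (f ^ k) = extPowMap q f ^ k := by
  induction k with
  | zero =>
    have := extPowMap_smul_one (R := R) (M := M) q 1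
    simpa using this
  | succ k ih =>
    rw [pow_succ, pow_succ, ← ih]
    exact extPowMap_mul q _ _

theorem statement3 (p n q : ℕ) [Fact p.Prime] (hp : Odd p) (hn : 1 ≤ n) (hq : q ≤ n)
    (Fq : Module.End ℤ_[p] (⋀[ℤ_[p]]^q (Fin n → ℤ_[p])))
    (hFq : Fq * extPowMap q (Vmap p n) =
      (p : ℤ_[p]) • (1 : Module.End ℤ_[p] (⋀[ℤ_[p]]^q (Fin n → ℤ_[p])))) :
    extPowMap q (Vmap p n) ^ (n - q) = Fq ^ q := by
  set W := extPowMap q (Vmap p n) with hW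
  have hWn : W ^ n = (p : ℤ_[p]) ^ q •
      (1 : Module.End ℤ_[p] (⋀[ℤ_[p]]^q (Fin n → ℤ_[p]))) := by
    rw [hW, ← extPowMap_pow, Vmap_pow_n, extPowMap_smul_one]
  have hk : ∀ k : ℕ, Fq ^ k * W ^ k = (p : ℤ_[p]) ^ k •
      (1 : Module.End ℤ_[p] (⋀[ℤ_[p]]^q (Fin n → ℤ_[p]))) := by
    intro k
    induction k with
    | zero => simp
    | succ k ih =>
      calc Fq ^ (k + 1) * W ^ (k + 1) = Fq ^ k * (Fq * W) * W ^ k := by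
            rw [pow_succ, pow_succ' W]; simp only [mul_assoc]
        _ = _ := by
            rw [hFq, mul_smul_comm, mul_one, smul_mul_assoc, ih, smul_smul, pow_succ']
  have h1 : (W ^ (n - q)) * W ^ q = Fq ^ q * W ^ q := by
    rw [hk, ← pow_add, Nat.sub_add_cancel hq, hWn]
  have h2 : (W ^ (n - q)) * W ^ n = Fq ^ q * W ^ n := by
    have h3 : W ^ n = W ^ q * W ^ (n - q) := by rw [← pow_add, Nat.add_sub_cancel' hq]
    rw [h3, ← mul_assoc, ← mul_assoc, h1]
  rw [hWn, mul_smul_comm, mul_smul_comm, mul_one, mul_one] at h2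
  have hp0 : (p : ℤ_[p]) ^ q ≠ 0 :=
    pow_ne_zero _ (Nat.cast_ne_zero.mpr (Fact.out : p.Prime).ne_zero)
  have : Module.Free ℤ_[p] (⋀[ℤ_[p]]^q (Fin n → ℤ_[p])) := inferInstance
  have : Module.IsTorsionFree ℤ_[p] (⋀[ℤ_[p]]^q (Fin n → ℤ_[p])) := inferInstance
  refine LinearMap.ext fun x => ?_
  have := LinearMap.congr_fun h2 x
  exact smul_right_injective _ hp0 this
end
end

section
/- Fix ν ≥ 1 and 0 ≤ q ≤ n, and let M_ν = M/p^ν M. The scalar product reduces mod p^ν to a pairing ⟨,⟩_ν : Λ^q M_ν ⊗ Λ^{n−q} M_ν → Z/p^ν (using Λ^q M_ν ≅ Λ^q M / p^ν Λ^q M), and: (i) the induced map Λ^{n−q} M_ν → Hom_{Z/p^ν}(Λ^q M_ν, Z/p^ν), B ↦ ⟨−, B⟩_ν, is an isomorphism of Z/p^ν-modules; (ii) ⟨(Λ^q V)A, B⟩_ν = (−1)^{n−1}⟨A, F_{n−q} B⟩_ν and ⟨F_q A, B⟩_ν = (−1)^{n−1}⟨A, (Λ^{n−q} V)B⟩_ν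 for all A, B. Hence for n odd the pairing satisfies ⟨VA,B⟩ = ⟨A,FB⟩ and ⟨FA,B⟩ = ⟨A,VB⟩ (a nondegenerate bilinear pairing of Dieudonné modules, exhibiting Λ^{n−q} M_ν as the dual of Λ^q M_ν), while for n even it satisfies the same identities with an extra minus sign (a nondegenerate twisted pairing). -/
set_option synthInstance.maxHeartbeats 1000000
set_option maxHeartbeats 1000000

/-! Statement 6: the scalar product `⟨A,B⟩` (defined by `A ∧ B = ⟨A,B⟩·a_*`) reduces mod
`p^ν` to a perfect pairing between `Λ^q M_ν` and `Λ^(n-q) M_ν`, compatible with `V` and the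
operators `F_q` up to the sign `(-1)^(n-1)`: a duality for `n` odd, a twisted duality for
`n` even. -/

noncomputable section

theorem aux_extPowMap_eq {R : Type} [CommRing R] {M : Type} [AddCommGroup M] [Module R M]
    (q : ℕ) (f : M →ₗ[R] M) : extPowMap q f = exteriorPower.map q f := by
  apply exteriorPower.linearMap_ext
  ext v
  simp only [LinearMap.compAlternatingMap_apply, exteriorPower.map_apply_ιMulti]
  simp [extPowMap, LinearMap.restrict_apply]

theorem aux_smul_id {R : Type} [CommRing R] {M : Type} [AddCommGroup M] [Module R M]
    (q : ℕ) (c : R) (x : ⋀[R]^q M) :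
    exteriorPower.map q (c • (LinearMap.id : M →ₗ[R] M)) x = c ^ q • x := by
  have : exteriorPower.map q (c • (LinearMap.id : M →ₗ[R] M)) = c ^ q • LinearMap.id := by
    apply exteriorPower.linearMap_ext
    ext v
    simp only [LinearMap.compAlternatingMap_apply, exteriorPower.map_apply_ιMulti]
    have h : (⇑(c • (LinearMap.id : M →ₗ[R] M)) ∘ v) = fun i => (fun _ : Fin q => c) i • v i := by
      ext i; simp
    rw [h, AlternatingMap.map_smul_univ]
    simp
  rw [this]; simp

theorem aux_VF (p n : ℕ) [Fact p.Prime] :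
    (Vmap p n) ∘ₗ (Fmap p n) = (p : ℤ_[p]) • LinearMap.id := by
  refine LinearMap.ext fun x => funext fun j => ?_
  have hj := j.isLt
  simp only [Vmap, Fmap, LinearMap.comp_apply, LinearMap.pi_apply, LinearMap.smul_apply,
    LinearMap.id_apply, Pi.smul_apply]
  by_cases h : (j : ℕ) + 1 < n
  · simp [h]
  · have hjj : (⟨n - 1, by omega⟩ : Fin n) = j := Fin.ext (by simp; omega)
    simp [h, hjj]

theorem aux_V_surj (p n k : ℕ) [Fact p.Prime] (B : ⋀[ℤ_[p]]^k (Fin n → ℤ_[p])) :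
    ∃ C, (p : ℤ_[p]) ^ k • B = extPowMap k (Vmap p n) C := by
  refine ⟨extPowMap k (Fmap p n) B, ?_⟩
  rw [aux_extPowMap_eq, aux_extPowMap_eq, ← LinearMap.comp_apply, ← exteriorPower.map_comp,
    aux_VF, aux_smul_id]

theorem aux_det (p n : ℕ) [Fact p.Prime] (hn : 1 ≤ n) :
    ExteriorAlgebra.map (Vmap p n)
      (ExteriorAlgebra.ιMulti ℤ_[p] n (fun i : Fin n => Pi.single i (1 : ℤ_[p]))) =
    ((-1) ^ (n - 1) * (p : ℤ_[p])) •
      ExteriorAlgebra.ιMulti ℤ_[p] n (fun i : Fin n => Pi.single i (1 : ℤ_[p])) := by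
  obtain ⟨m, rfl⟩ : ∃ m, n = m + 1 := ⟨n - 1, by omega⟩
  rw [ExteriorAlgebra.map_apply_ιMulti]
  have h : (⇑(Vmap p (m + 1)) ∘ fun i : Fin (m + 1) => (Pi.single i (1 : ℤ_[p]) : Fin (m + 1) → ℤ_[p]))
      = fun i => (if i = 0 then (p : ℤ_[p]) else 1) •
        ((fun i : Fin (m + 1) => (Pi.single i (1 : ℤ_[p]) : Fin (m + 1) → ℤ_[p])) ∘
          (finRotate (m + 1)).symm) i := by
    funext i j
    have key : ((finRotate (m + 1)).symm i = j) ↔ i = finRotate (m + 1) j :=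
      Equiv.symm_apply_eq _
    simp only [Function.comp_apply, Vmap, LinearMap.pi_apply, Pi.smul_apply, Pi.single_apply,
      eq_comm (a := j), key]
    by_cases hj : (j : ℕ) + 1 < m + 1
    · have e : finRotate (m + 1) j = ⟨j + 1, hj⟩ := finRotate_of_lt (by omega)
      rw [e]
      simp only [hj, dite_true, LinearMap.proj_apply, Pi.single_apply]
      by_cases hi : i = ⟨j + 1, hj⟩
      · subst hi
        have h0 : ¬ ((⟨j + 1, hj⟩ : Fin (m + 1)) = 0) := fun h => by
          have := congrArg Fin.val h
          exact Nat.succ_ne_zero _ this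
        rw [if_pos rfl, if_neg h0, one_smul]
      · rw [if_neg (Ne.symm hi), if_neg hi, smul_zero]
    · have e : j = Fin.last m := Fin.ext (by simp; omega)
      subst e
      rw [finRotate_last]
      simp [Pi.single_apply, eq_comm]
      split_ifs <;> rfl
  rw [h, AlternatingMap.map_smul_univ, AlternatingMap.map_perm]
  simp only [Finset.prod_ite_eq', Finset.mem_univ, if_true, Equiv.Perm.sign_symm, sign_finRotate]
  rw [mul_comm, mul_smul]
  congr 1
  rcases neg_one_pow_eq_or ℤˣ (m + 1 - 1) with h1 | h1
  · have : ((-1 : ℤ_[p]) ^ (m + 1 - 1)) = 1 := by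
      have := congrArg (fun u : ℤˣ => ((u : ℤ) : ℤ_[p])) h1
      simpa using this
    rw [h1, this]; simp
  · have : ((-1 : ℤ_[p]) ^ (m + 1 - 1)) = -1 := by
      have := congrArg (fun u : ℤˣ => ((u : ℤ) : ℤ_[p])) h1
      simpa using this
    rw [h1, this]; simp

theorem aux_top (R : Type) [CommRing R] (n : ℕ) :
    (Pi.basisFun R (Fin n)).ExteriorAlgebra Finset.univ =
      ExteriorAlgebra.ιMulti R n (fun i : Fin n => Pi.single i (1 : R)) := by
  rw [ExteriorAlgebra.basis_apply_ofCard (n := n) _ (by simp), ExteriorAlgebra.ιMulti_family]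
  congr 1
  funext i
  rw [Function.comp_apply, Set.powersetCard.ofFinEmbEquiv_symm_apply, Pi.basisFun_apply]
  congr 1
  have := Finset.orderEmbOfFin_unique (s := (Finset.univ : Finset (Fin n))) (k := n) (by simp)
    (f := id) (by simp) strictMono_id
  exact (congrFun this i).symm

theorem aux_card {n q : ℕ} (hq : q ≤ n) : (n - q) + q = Fintype.card (Fin n) := by
  simp; omega

theorem aux_mul (R : Type) [CommRing R] (n q : ℕ) (hq : q ≤ n)
    (s : Set.powersetCard (Fin n) q) :
    ∃ u : ℤˣ, ∀ t : Set.powersetCard (Fin n) (n - q),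
    (((Pi.basisFun R (Fin n)).exteriorPower q s : ExteriorAlgebra R (Fin n → R)) *
      ((Pi.basisFun R (Fin n)).exteriorPower (n - q) t : ExteriorAlgebra R (Fin n → R))) =
      (if t = Set.powersetCard.compl (aux_card hq) s then ((u : ℤ) : R) else 0) •
      ExteriorAlgebra.ιMulti R n (fun i : Fin n => Pi.single i (1 : R)) := by
  have hd : Disjoint s.val (Set.powersetCard.compl (aux_card hq) s).val := by
    rw [Set.powersetCard.coe_compl]; exact disjoint_compl_right
  refine ⟨(Set.powersetCard.permOfDisjoint hd).sign, fun t => ?_⟩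
  rw [← ExteriorAlgebra.basis_eq_coe_basis, ← ExteriorAlgebra.basis_eq_coe_basis]
  split_ifs with h
  · subst h
    rw [ExteriorAlgebra.basis_mul_of_disjoint _ _ _ hd, ← aux_top]
    have hu : ((Set.powersetCard.disjUnion hd : Set.powersetCard (Fin n) _) : Finset (Fin n))
        = Finset.univ := by
      ext i
      simp
    rw [hu, Units.smul_def, Int.cast_smul_eq_zsmul]
  · rw [zero_smul]
    apply ExteriorAlgebra.basis_mul_of_not_disjoint
    intro hd'
    apply h
    rw [Set.powersetCard.eq_iff_subset, Set.powersetCard.coe_compl]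
    exact le_compl_iff_disjoint_left.mpr hd'

/-- The coefficient of the top form. -/
def auxL (R : Type) [CommRing R] (n : ℕ) : ExteriorAlgebra R (Fin n → R) →ₗ[R] R :=
  (Pi.basisFun R (Fin n)).ExteriorAlgebra.coord Finset.univ

theorem auxL_top (R : Type) [CommRing R] (n : ℕ) :
    auxL R n (ExteriorAlgebra.ιMulti R n (fun i : Fin n => Pi.single i (1 : R))) = 1 := by
  rw [← aux_top, auxL]; simp

/-- The scalar product. -/
def auxPair (R : Type) [CommRing R] (n q : ℕ) :
    ⋀[R]^q (Fin n → R) →ₗ[R] ⋀[R]^(n - q) (Fin n → R) →ₗ[R] R :=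
  ((LinearMap.mul R (ExteriorAlgebra R (Fin n → R))).compr₂ (auxL R n)).compl₁₂
    (⋀[R]^q (Fin n → R)).subtype (⋀[R]^(n - q) (Fin n → R)).subtype

theorem auxPair_apply (R : Type) [CommRing R] (n q : ℕ) (A : ⋀[R]^q (Fin n → R))
    (B : ⋀[R]^(n - q) (Fin n → R)) :
    auxPair R n q A B = auxL R n ((A : ExteriorAlgebra R (Fin n → R)) * B) := rfl

theorem auxPair_spec (R : Type) [CommRing R] (n q : ℕ) (hq : q ≤ n) (A : ⋀[R]^q (Fin n → R))
    (B : ⋀[R]^(n - q) (Fin n → R)) :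
    ((A : ExteriorAlgebra R (Fin n → R)) * B) = auxPair R n q A B •
      ExteriorAlgebra.ιMulti R n (fun i : Fin n => Pi.single i (1 : R)) := by
  have : (LinearMap.mul R (ExteriorAlgebra R (Fin n → R))).compl₁₂
      (⋀[R]^q (Fin n → R)).subtype (⋀[R]^(n - q) (Fin n → R)).subtype =
      (auxPair R n q).compr₂ (LinearMap.toSpanSingleton R _
        (ExteriorAlgebra.ιMulti R n (fun i : Fin n => Pi.single i (1 : R)))) := by
    refine ((Pi.basisFun R (Fin n)).exteriorPower q).ext fun s => ?_
    refine ((Pi.basisFun R (Fin n)).exteriorPower (n - q)).ext fun t => ?_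
    obtain ⟨u, hu⟩ := aux_mul R n q hq s
    simp only [LinearMap.compl₁₂_apply, LinearMap.compr₂_apply, Submodule.subtype_apply,
      LinearMap.mul_apply', LinearMap.toSpanSingleton_apply, auxPair_apply]
    rw [hu t, map_smul, auxL_top, smul_eq_mul, mul_one]
  exact LinearMap.congr_fun₂ this A B

theorem auxPair_repr (R : Type) [CommRing R] (n q : ℕ) (hq : q ≤ n)
    (s : Set.powersetCard (Fin n) q) :
    ∃ u : ℤˣ, ∀ B, auxPair R n q ((Pi.basisFun R (Fin n)).exteriorPower q s) B =
      ((u : ℤ) : R) * ((Pi.basisFun R (Fin n)).exteriorPower (n - q)).repr B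
        (Set.powersetCard.compl (aux_card hq) s) := by
  obtain ⟨u, hu⟩ := aux_mul R n q hq s
  refine ⟨u, fun B => ?_⟩
  have : auxPair R n q ((Pi.basisFun R (Fin n)).exteriorPower q s) = ((u : ℤ) : R) •
      ((Pi.basisFun R (Fin n)).exteriorPower (n - q)).coord
        (Set.powersetCard.compl (aux_card hq) s) := by
    refine ((Pi.basisFun R (Fin n)).exteriorPower (n - q)).ext fun t => ?_
    rw [auxPair_apply, hu t, map_smul, auxL_top, LinearMap.smul_apply, Module.Basis.coord_apply,
      Module.Basis.repr_self, Finsupp.single_apply]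
    simp
  rw [this]; simp

theorem auxPair_VV (p n q : ℕ) [Fact p.Prime] (hn : 1 ≤ n) (hq : q ≤ n)
    (A : ⋀[ℤ_[p]]^q (Fin n → ℤ_[p])) (B : ⋀[ℤ_[p]]^(n - q) (Fin n → ℤ_[p])) :
    auxPair ℤ_[p] n q (extPowMap q (Vmap p n) A) (extPowMap (n - q) (Vmap p n) B) =
      ((-1) ^ (n - 1) * (p : ℤ_[p])) * auxPair ℤ_[p] n q A B := by
  have h : ((extPowMap q (Vmap p n) A : ExteriorAlgebra ℤ_[p] (Fin n → ℤ_[p])) *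
      (extPowMap (n - q) (Vmap p n) B)) = ExteriorAlgebra.map (Vmap p n)
        ((A : ExteriorAlgebra ℤ_[p] (Fin n → ℤ_[p])) * B) := by
    rw [map_mul]; rfl
  rw [auxPair_apply, h, auxPair_spec _ _ _ hq, map_smul, aux_det _ _ hn, map_smul, map_smul,
    auxL_top]
  simp [mul_comm]

theorem auxPair_VF (p n q : ℕ) [Fact p.Prime] (hn : 1 ≤ n) (hq : q ≤ n)
    (G : Module.End ℤ_[p] (⋀[ℤ_[p]]^(n - q) (Fin n → ℤ_[p])))
    (hG : G * extPowMap (n - q) (Vmap p n) = (p : ℤ_[p]) • 1)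
    (A : ⋀[ℤ_[p]]^q (Fin n → ℤ_[p])) (B : ⋀[ℤ_[p]]^(n - q) (Fin n → ℤ_[p])) :
    auxPair ℤ_[p] n q (extPowMap q (Vmap p n) A) B =
      (-1) ^ (n - 1) * auxPair ℤ_[p] n q A (G B) := by
  obtain ⟨C, hC⟩ := aux_V_surj p n (n - q) B
  have hp0 : (p : ℤ_[p]) ^ (n - q) ≠ 0 :=
    pow_ne_zero _ (Nat.cast_ne_zero.mpr (Fact.out : p.Prime).ne_zero)
  have hGC : G (extPowMap (n - q) (Vmap p n) C) = (p : ℤ_[p]) • C := LinearMap.congr_fun hG C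
  apply mul_left_cancel₀ hp0
  have h1 : (p : ℤ_[p]) ^ (n - q) * auxPair ℤ_[p] n q (extPowMap q (Vmap p n) A) B =
      ((-1) ^ (n - 1) * (p : ℤ_[p])) * auxPair ℤ_[p] n q A C := by
    rw [← auxPair_VV p n q hn hq, ← hC, map_smul, smul_eq_mul]
  have h2 : (p : ℤ_[p]) ^ (n - q) * auxPair ℤ_[p] n q A (G B) =
      (p : ℤ_[p]) * auxPair ℤ_[p] n q A C := by
    rw [← smul_eq_mul, ← map_smul, ← map_smul, hC, hGC, map_smul, smul_eq_mul]
  rw [h1, mul_left_comm, h2, mul_assoc]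

theorem auxPair_FV (p n q : ℕ) [Fact p.Prime] (hn : 1 ≤ n) (hq : q ≤ n)
    (G : Module.End ℤ_[p] (⋀[ℤ_[p]]^q (Fin n → ℤ_[p])))
    (hG : G * extPowMap q (Vmap p n) = (p : ℤ_[p]) • 1)
    (A : ⋀[ℤ_[p]]^q (Fin n → ℤ_[p])) (B : ⋀[ℤ_[p]]^(n - q) (Fin n → ℤ_[p])) :
    auxPair ℤ_[p] n q (G A) B =
      (-1) ^ (n - 1) * auxPair ℤ_[p] n q A (extPowMap (n - q) (Vmap p n) B) := by
  obtain ⟨C, hC⟩ := aux_V_surj p n q A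
  have hp0 : (p : ℤ_[p]) ^ q ≠ 0 :=
    pow_ne_zero _ (Nat.cast_ne_zero.mpr (Fact.out : p.Prime).ne_zero)
  have hGC : G (extPowMap q (Vmap p n) C) = (p : ℤ_[p]) • C := LinearMap.congr_fun hG C
  apply mul_left_cancel₀ hp0
  have h1 : (p : ℤ_[p]) ^ q * auxPair ℤ_[p] n q A (extPowMap (n - q) (Vmap p n) B) =
      ((-1) ^ (n - 1) * (p : ℤ_[p])) * auxPair ℤ_[p] n q C B := by
    rw [← auxPair_VV p n q hn hq, ← hC, map_smul, LinearMap.smul_apply, smul_eq_mul]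
  have h2 : (p : ℤ_[p]) ^ q * auxPair ℤ_[p] n q (G A) B =
      (p : ℤ_[p]) * auxPair ℤ_[p] n q C B := by
    rw [← smul_eq_mul, ← LinearMap.smul_apply, ← map_smul, ← map_smul, hC, hGC, map_smul,
      LinearMap.smul_apply, smul_eq_mul]
  rw [mul_left_comm, h1, h2, mul_assoc, ← mul_assoc, ← mul_pow]
  simp

theorem aux_toZMod_zero (p ν : ℕ) [Fact p.Prime] (x : ℤ_[p]) :
    PadicInt.toZModPow ν x = 0 ↔ ∃ c, x = (p : ℤ_[p]) ^ ν * c := by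
  rw [← RingHom.mem_ker, PadicInt.ker_toZModPow, Ideal.mem_span_singleton]
  rfl

theorem aux_toZMod_surj (p ν : ℕ) [Fact p.Prime] (x : ZMod (p ^ ν)) :
    ∃ c : ℤ_[p], PadicInt.toZModPow ν c = x :=
  ⟨(x.cast : ℤ), by simp⟩

theorem aux_semilin (p ν : ℕ) [Fact p.Prime] {N : Type} [AddCommGroup N] [Module ℤ_[p] N]
    (f : N →+ ZMod (p ^ ν)) (c : ℤ_[p]) (x : N) :
    f (c • x) = PadicInt.toZModPow ν c * f x := by
  obtain ⟨d, hd⟩ := (aux_toZMod_zero p ν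
    (c - (((PadicInt.toZModPow ν c).cast : ℤ) : ℤ_[p]))).1 (by simp)
  have hc : c = (((PadicInt.toZModPow ν c).cast : ℤ) : ℤ_[p]) + (p : ℤ_[p]) ^ ν * d := by
    rw [← hd]; ring
  conv_lhs => rw [hc]
  rw [add_smul, map_add, mul_smul, Int.cast_smul_eq_zsmul, map_zsmul, ← Nat.cast_pow,
    Nat.cast_smul_eq_nsmul, map_nsmul]
  simp

theorem statement6 (p n q ν : ℕ) [Fact p.Prime] (hp : Odd p) (hn : 1 ≤ n) (hq : q ≤ n)
    (hν : 1 ≤ ν) :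
    ∃ pair : ⋀[ℤ_[p]]^q (Fin n → ℤ_[p]) →ₗ[ℤ_[p]]
        ⋀[ℤ_[p]]^(n - q) (Fin n → ℤ_[p]) →ₗ[ℤ_[p]] ℤ_[p],
      -- the scalar product: `A ∧ B = ⟨A,B⟩ • a_*`
      (∀ (A : ⋀[ℤ_[p]]^q (Fin n → ℤ_[p])) (B : ⋀[ℤ_[p]]^(n - q) (Fin n → ℤ_[p])),
        ((↑A : ExteriorAlgebra ℤ_[p] (Fin n → ℤ_[p])) * ↑B) =
          pair A B •
            ExteriorAlgebra.ιMulti ℤ_[p] n (fun i : Fin n => Pi.single i (1 : ℤ_[p]))) ∧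
      -- it descends to a pairing `⟨,⟩_ν` on the reductions mod `p^ν`
      (∀ (A A' : ⋀[ℤ_[p]]^q (Fin n → ℤ_[p])) (B B' : ⋀[ℤ_[p]]^(n - q) (Fin n → ℤ_[p])),
        (∃ C, A - A' = (p : ℤ_[p]) ^ ν • C) → (∃ C, B - B' = (p : ℤ_[p]) ^ ν • C) →
        PadicInt.toZModPow ν (pair A B) = PadicInt.toZModPow ν (pair A' B')) ∧
      -- (i) the induced map `Λ^(n-q) M_ν → Hom(Λ^q M_ν, ℤ/p^ν)` is an isomorphism:
      -- surjectivity ...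
      (∀ f : ⋀[ℤ_[p]]^q (Fin n → ℤ_[p]) →+ ZMod (p ^ ν),
        ∃ B, ∀ A, PadicInt.toZModPow ν (pair A B) = f A) ∧
      -- ... and the kernel is exactly `p^ν·Λ^(n-q) M`
      (∀ B, (∀ A, PadicInt.toZModPow ν (pair A B) = 0) ↔
        ∃ C, B = (p : ℤ_[p]) ^ ν • C) ∧
      -- (ii) compatibility with `V` and `F` up to the sign `(-1)^(n-1)`
      (∀ Fnq : Module.End ℤ_[p] (⋀[ℤ_[p]]^(n - q) (Fin n → ℤ_[p])),
        Fnq * extPowMap (n - q) (Vmap p n) =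
          (p : ℤ_[p]) • (1 : Module.End ℤ_[p] (⋀[ℤ_[p]]^(n - q) (Fin n → ℤ_[p]))) →
        ∀ A B, PadicInt.toZModPow ν (pair (extPowMap q (Vmap p n) A) B) =
          (-1 : ZMod (p ^ ν)) ^ (n - 1) * PadicInt.toZModPow ν (pair A (Fnq B))) ∧
      (∀ Fq : Module.End ℤ_[p] (⋀[ℤ_[p]]^q (Fin n → ℤ_[p])),
        Fq * extPowMap q (Vmap p n) =
          (p : ℤ_[p]) • (1 : Module.End ℤ_[p] (⋀[ℤ_[p]]^q (Fin n → ℤ_[p]))) →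
        ∀ A B, PadicInt.toZModPow ν (pair (Fq A) B) =
          (-1 : ZMod (p ^ ν)) ^ (n - 1) *
            PadicInt.toZModPow ν (pair A (extPowMap (n - q) (Vmap p n) B))) ∧
      -- hence: for `n` odd an (untwisted) bilinear pairing of Dieudonné modules ...
      (Odd n →
        ∀ (Fq : Module.End ℤ_[p] (⋀[ℤ_[p]]^q (Fin n → ℤ_[p])))
          (Fnq : Module.End ℤ_[p] (⋀[ℤ_[p]]^(n - q) (Fin n → ℤ_[p]))),
          Fq * extPowMap q (Vmap p n) =
            (p : ℤ_[p]) • (1 : Module.End ℤ_[p] (⋀[ℤ_[p]]^q (Fin n → ℤ_[p]))) →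
          Fnq * extPowMap (n - q) (Vmap p n) =
            (p : ℤ_[p]) • (1 : Module.End ℤ_[p] (⋀[ℤ_[p]]^(n - q) (Fin n → ℤ_[p]))) →
          (∀ A B, PadicInt.toZModPow ν (pair (extPowMap q (Vmap p n) A) B) =
              PadicInt.toZModPow ν (pair A (Fnq B))) ∧
          (∀ A B, PadicInt.toZModPow ν (pair (Fq A) B) =
              PadicInt.toZModPow ν (pair A (extPowMap (n - q) (Vmap p n) B)))) ∧
      -- ... and for `n` even a twisted pairing (the same identities with a minus sign)
      (Even n →
        ∀ (Fq : Module.End ℤ_[p] (⋀[ℤ_[p]]^q (Fin n → ℤ_[p])))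
          (Fnq : Module.End ℤ_[p] (⋀[ℤ_[p]]^(n - q) (Fin n → ℤ_[p]))),
          Fq * extPowMap q (Vmap p n) =
            (p : ℤ_[p]) • (1 : Module.End ℤ_[p] (⋀[ℤ_[p]]^q (Fin n → ℤ_[p]))) →
          Fnq * extPowMap (n - q) (Vmap p n) =
            (p : ℤ_[p]) • (1 : Module.End ℤ_[p] (⋀[ℤ_[p]]^(n - q) (Fin n → ℤ_[p]))) →
          (∀ A B, PadicInt.toZModPow ν (pair (extPowMap q (Vmap p n) A) B) =
              - PadicInt.toZModPow ν (pair A (Fnq B))) ∧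
          (∀ A B, PadicInt.toZModPow ν (pair (Fq A) B) =
              - PadicInt.toZModPow ν (pair A (extPowMap (n - q) (Vmap p n) B)))) := by
  classical
  have hVF : ∀ Fnq : Module.End ℤ_[p] (⋀[ℤ_[p]]^(n - q) (Fin n → ℤ_[p])),
        Fnq * extPowMap (n - q) (Vmap p n) =
          (p : ℤ_[p]) • (1 : Module.End ℤ_[p] (⋀[ℤ_[p]]^(n - q) (Fin n → ℤ_[p]))) →
        ∀ A B, PadicInt.toZModPow ν (auxPair ℤ_[p] n q (extPowMap q (Vmap p n) A) B) =
          (-1 : ZMod (p ^ ν)) ^ (n - 1) *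
            PadicInt.toZModPow ν (auxPair ℤ_[p] n q A (Fnq B)) := by
    intro G hG A B
    rw [auxPair_VF p n q hn hq G hG]
    simp
  have hFV : ∀ Fq : Module.End ℤ_[p] (⋀[ℤ_[p]]^q (Fin n → ℤ_[p])),
        Fq * extPowMap q (Vmap p n) =
          (p : ℤ_[p]) • (1 : Module.End ℤ_[p] (⋀[ℤ_[p]]^q (Fin n → ℤ_[p]))) →
        ∀ A B, PadicInt.toZModPow ν (auxPair ℤ_[p] n q (Fq A) B) =
          (-1 : ZMod (p ^ ν)) ^ (n - 1) *
            PadicInt.toZModPow ν (auxPair ℤ_[p] n q A (extPowMap (n - q) (Vmap p n) B)) := by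
    intro G hG A B
    rw [auxPair_FV p n q hn hq G hG]
    simp
  choose u hu using auxPair_repr ℤ_[p] n q hq
  let e := Set.powersetCard.compl (α := Fin n) (aux_card hq)
  let β := (Pi.basisFun ℤ_[p] (Fin n)).exteriorPower q
  let β' := (Pi.basisFun ℤ_[p] (Fin n)).exteriorPower (n - q)
  have hu' : ∀ s B, auxPair ℤ_[p] n q (β s) B = ((u s : ℤ) : ℤ_[p]) * β'.repr B (e s) := hu
  have huu : ∀ s, ((u s : ℤ) : ℤ_[p]) * ((u s : ℤ) : ℤ_[p]) = 1 := by
    intro s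
    rw [← Int.cast_mul, ← Units.val_mul, Int.units_mul_self]; simp
  refine ⟨auxPair ℤ_[p] n q, auxPair_spec ℤ_[p] n q hq, ?_, ?_, ?_, hVF, hFV, ?_, ?_⟩
  · rintro A A' B B' ⟨C, hC⟩ ⟨D, hD⟩
    rw [← sub_eq_zero, ← map_sub, aux_toZMod_zero]
    refine ⟨auxPair ℤ_[p] n q C B + auxPair ℤ_[p] n q A' D, ?_⟩
    have h1 : auxPair ℤ_[p] n q (A - A') B + auxPair ℤ_[p] n q A' (B - B') =
        auxPair ℤ_[p] n q A B - auxPair ℤ_[p] n q A' B' := by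
      rw [map_sub, map_sub, LinearMap.sub_apply]; ring
    rw [← h1, hC, hD, map_smul, map_smul, LinearMap.smul_apply, smul_eq_mul, smul_eq_mul, mul_add]
  · intro f
    choose c hc using fun s => aux_toZMod_surj p ν (f (β s))
    refine ⟨β'.equivFun.symm fun t => ((u (e.symm t) : ℤ) : ℤ_[p]) * c (e.symm t), fun A => ?_⟩
    set B := β'.equivFun.symm fun t => ((u (e.symm t) : ℤ) : ℤ_[p]) * c (e.symm t) with hB
    have hr : ∀ s, auxPair ℤ_[p] n q (β s) B = c s := by
      intro s
      rw [hu', ← Module.Basis.equivFun_apply, hB, LinearEquiv.apply_symm_apply,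
        Equiv.symm_apply_apply, ← mul_assoc, huu, one_mul]
    rw [← β.sum_repr A]
    simp only [map_sum, LinearMap.sum_apply, map_smul, LinearMap.smul_apply, smul_eq_mul, map_mul,
      hr, hc, aux_semilin]
  · intro B
    constructor
    · intro h
      have h2 : ∀ t, ∃ c, β'.repr B t = (p : ℤ_[p]) ^ ν * c := by
        intro t
        obtain ⟨c, hc⟩ := (aux_toZMod_zero p ν _).1 (h (β (e.symm t)))
        rw [hu', Equiv.apply_symm_apply] at hc
        refine ⟨((u (e.symm t) : ℤ) : ℤ_[p]) * c, ?_⟩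
        rw [mul_left_comm, ← hc, ← mul_assoc, huu, one_mul]
      choose c hc using h2
      refine ⟨β'.equivFun.symm c, ?_⟩
      apply β'.equivFun.injective
      rw [map_smul, LinearEquiv.apply_symm_apply]
      funext t
      rw [Module.Basis.equivFun_apply, hc]; rfl
    · rintro ⟨C, rfl⟩ A
      rw [aux_toZMod_zero]
      exact ⟨_, by rw [map_smul, smul_eq_mul]⟩
  · intro ho G G' hG hG'
    have hs : (-1 : ZMod (p ^ ν)) ^ (n - 1) = 1 := Even.neg_one_pow (by
      obtain ⟨k, hk⟩ := ho; exact ⟨k, by omega⟩)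
    exact ⟨fun A B => by rw [hVF G' hG', hs, one_mul], fun A B => by rw [hFV G hG, hs, one_mul]⟩
  · intro ho G G' hG hG'
    have hs : (-1 : ZMod (p ^ ν)) ^ (n - 1) = -1 := Odd.neg_one_pow (by
      obtain ⟨k, hk⟩ := ho; exact ⟨k - 1, by omega⟩)
    exact ⟨fun A B => by rw [hVF G' hG', hs, neg_one_mul],
      fun A B => by rw [hFV G hG, hs, neg_one_mul]⟩
end
end
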